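/- Let M be a preprojective k(Γ,Λ)-module. Then there exists a unique up to ∼ shortest sequence S_M ∈ 𝔖 annihilating M. Moreover, if M ≅ M₁^{m₁} ⊕ ⋯ ⊕ M_t^{m_t} where the M_i are pairwise nonisomorphic indecomposable k(Γ,Λ)-modules and m_i > 0 for all i, then each M_i is preprojective and S_M ∼ S_{M₁} ∨ ⋯ ∨ S_{M_t}. -/

import Mathlib

namespace KP

/-! ## Quivers on a fixed vertex set `Fin n`.

An orientation is encoded by `Λ : Fin n → Fin n → ℕ`, where `Λ a b` is the number of
arrows from `a` to `b`.  The underlying graph is recorded by `edges Λ a b = Λ a b + Λ b a`. -/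

/-- The orientation `σ_x Λ` obtained by reversing every arrow incident with `x`. -/
def flipO {n : ℕ} (x : Fin n) (Λ : Fin n → Fin n → ℕ) : Fin n → Fin n → ℕ :=
  fun a b => if a = x ∨ b = x then Λ b a else Λ a b

/-- Number of edges of the underlying graph joining `a` and `b`. -/
def edges {n : ℕ} (Λ : Fin n → Fin n → ℕ) (a b : Fin n) : ℕ := Λ a b + Λ b a

/-- `x` is a sink: no arrow starts at `x`. -/
def IsSink {n : ℕ} (Λ : Fin n → Fin n → ℕ) (x : Fin n) : Prop := ∀ y, Λ x y = 0

/-- `S` is a `(+)`-admissible sequence of vertices on `(Γ, Λ)`. -/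
def Admissible {n : ℕ} (Λ : Fin n → Fin n → ℕ) : List (Fin n) → Prop
  | [] => True
  | x :: xs => IsSink Λ x ∧ Admissible (flipO x Λ) xs

/-- The orientation `Λ^S`. -/
def orientAfter {n : ℕ} (Λ : Fin n → Fin n → ℕ) : List (Fin n) → (Fin n → Fin n → ℕ)
  | [] => Λ
  | x :: xs => orientAfter (flipO x Λ) xs

/-- Elementary move: interchange two consecutive vertices not joined by an edge. -/
inductive SwapRel {n : ℕ} (E : Fin n → Fin n → ℕ) : List (Fin n) → List (Fin n) → Prop
  | swap (l₁ l₂ : List (Fin n)) (a b : Fin n) (h : E a b = 0) :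
      SwapRel E (l₁ ++ a :: b :: l₂) (l₁ ++ b :: a :: l₂)

/-- The equivalence `∼` on sequences of vertices: reflexive–transitive closure of the
(symmetric) relation `SwapRel`. -/
def Sim {n : ℕ} (E : Fin n → Fin n → ℕ) : List (Fin n) → List (Fin n) → Prop :=
  Relation.ReflTransGen (SwapRel E)

/-- The preorder `S ⪯ T` : `T ∼ S ++ U` for some `(+)`-admissible sequence `U` on `(Γ, Λ^S)`. -/
def Preceq {n : ℕ} (Λ : Fin n → Fin n → ℕ) (S T : List (Fin n)) : Prop :=
  ∃ U, Admissible (orientAfter Λ S) U ∧ Sim (edges Λ) T (S ++ U)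

/-- Support of a sequence of vertices. -/
def suppOf {n : ℕ} (S : List (Fin n)) : Set (Fin n) := {v | v ∈ S}

/-- The partial order on vertices: `x ≤ y` iff there is a path from `x` to `y` in `(Γ, Λ)`. -/
def PathLE {n : ℕ} (Λ : Fin n → Fin n → ℕ) (x y : Fin n) : Prop :=
  Relation.ReflTransGen (fun a b => Λ a b ≠ 0) x y

/-- A filter (up-closed set) of the poset `(Γ₀, Λ)`. -/
def IsFilter {n : ℕ} (Λ : Fin n → Fin n → ℕ) (F : Set (Fin n)) : Prop :=
  ∀ x ∈ F, ∀ y, PathLE Λ x y → y ∈ F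

/-- The principal filter `⟨x⟩`. -/
def upSet {n : ℕ} (Λ : Fin n → Fin n → ℕ) (x : Fin n) : Set (Fin n) := {y | PathLE Λ x y}

/-- The hull `H_Λ(F)`: the smallest filter containing `F` and every vertex joined
by an edge to a vertex of `F`. -/
def hull {n : ℕ} (Λ : Fin n → Fin n → ℕ) (F : Set (Fin n)) : Set (Fin n) :=
  {y | ∃ x, (x ∈ F ∨ ∃ z ∈ F, edges Λ z x ≠ 0) ∧ PathLE Λ x y}

/-- `segs` is a canonical form of `S` (Proposition 2.1): `S ∼ S₁S₂⋯S_r`, each segment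
consists of distinct vertices, is nonempty, and `Supp S_i = Supp (S_i S_{i+1} ⋯ S_r)`. -/
def Segments {n : ℕ} (Λ : Fin n → Fin n → ℕ) (S : List (Fin n))
    (segs : List (List (Fin n))) : Prop :=
  Admissible Λ segs.flatten ∧ Sim (edges Λ) S segs.flatten ∧
  (∀ seg ∈ segs, seg ≠ [] ∧ seg.Nodup) ∧
  ∀ i, i < segs.length → suppOf (segs.getD i []) = suppOf ((segs.drop i).flatten)

/-- `J` is (a representative of) the join `S ∨ T` (Definition 2.4):  the canonical form of `J`
has `Supp R_i = Supp S_i ∪ Supp T_i` (out-of-range segments read as `∅`). -/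
def IsJoin {n : ℕ} (Λ : Fin n → Fin n → ℕ) (S T J : List (Fin n)) : Prop :=
  ∃ CS CT CJ, Segments Λ S CS ∧ Segments Λ T CT ∧ Segments Λ J CJ ∧
    ∀ i, suppOf (CJ.getD i []) = suppOf (CS.getD i []) ∪ suppOf (CT.getD i [])

/-- `M` is (a representative of) the meet `S ∧ T` (Definition 2.4). -/
def IsMeet {n : ℕ} (Λ : Fin n → Fin n → ℕ) (S T M : List (Fin n)) : Prop :=
  ∃ CS CT CM, Segments Λ S CS ∧ Segments Λ T CT ∧ Segments Λ M CM ∧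
    ∀ i, suppOf (CM.getD i []) = suppOf (CS.getD i []) ∩ suppOf (CT.getD i [])

/-- `S` is (equivalent to) the join `T₁ ∨ ⋯ ∨ T_l` of the list of sequences `Ts`. -/
def IsJoinList {n : ℕ} (Λ : Fin n → Fin n → ℕ) : List (List (Fin n)) → List (Fin n) → Prop
  | [], S => S = []
  | T :: Ts, S => ∃ J, IsJoinList Λ Ts J ∧ IsJoin Λ T J S

/-- The segments of a canonical form of a principal sequence `S_{r,x}` (Definition 3.1). -/
def PrincipalSegs {n : ℕ} (Λ : Fin n → Fin n → ℕ) (segs : List (List (Fin n)))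
    (r : ℕ) (x : Fin n) : Prop :=
  segs.length = r ∧ 0 < r ∧
  (∀ i, i + 1 < r → suppOf (segs.getD i []) = hull Λ (suppOf (segs.getD (i+1) []))) ∧
  suppOf (segs.getD (r-1) []) = upSet Λ x

/-- `S ∼ S_{r,x}`, the principal `(+)`-admissible sequence of size `r` with
`Supp S_r = ⟨x⟩`. -/
def IsPrincipalSeq {n : ℕ} (Λ : Fin n → Fin n → ℕ) (r : ℕ) (x : Fin n)
    (S : List (Fin n)) : Prop :=
  ∃ segs, Segments Λ S segs ∧ PrincipalSegs Λ segs r x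

/-- `S` is a principal `(+)`-admissible sequence. -/
def IsPrincipal {n : ℕ} (Λ : Fin n → Fin n → ℕ) (S : List (Fin n)) : Prop :=
  ∃ r x, IsPrincipalSeq Λ r x S


/-! ## Representations of `(Γ, Λ)` over a field `k`. -/

/-- A (finite-dimensional) representation of the quiver `(Γ, Λ)` over `k`:
the space at vertex `x` is `Fin (d x) → k`, and each arrow carries a linear map. -/
structure Rep (k : Type) [Field k] (n : ℕ) (Λ : Fin n → Fin n → ℕ) where
  d : Fin n → ℕ
  f : ∀ a b : Fin n, Fin (Λ a b) → ((Fin (d a) → k) →ₗ[k] (Fin (d b) → k))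

variable {k : Type} [Field k] {n : ℕ}

/-- A morphism of representations. -/
structure RepHom {Λ : Fin n → Fin n → ℕ} (M N : Rep k n Λ) where
  g : ∀ x, (Fin (M.d x) → k) →ₗ[k] (Fin (N.d x) → k)
  comm : ∀ a b i v, g b (M.f a b i v) = N.f a b i (g a v)

/-- Isomorphism of representations. -/
def RepIso {Λ : Fin n → Fin n → ℕ} (M N : Rep k n Λ) : Prop :=
  ∃ g : ∀ x, (Fin (M.d x) → k) ≃ₗ[k] (Fin (N.d x) → k),
    ∀ a b i v, g b (M.f a b i v) = N.f a b i (g a v)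

/-- The zero representation. -/
def IsZeroRep {Λ : Fin n → Fin n → ℕ} (M : Rep k n Λ) : Prop := ∀ x, M.d x = 0

/-- Cast between the standard spaces. -/
def castL (k : Type) [Field k] {m m' : ℕ} (h : m = m') : (Fin m → k) ≃ₗ[k] (Fin m' → k) :=
  LinearEquiv.funCongrLeft k k (finCongr h.symm)

/-- The splitting `(Fin (m + p) → k) ≃ₗ (Fin m → k) × (Fin p → k)`. -/
def splitL (k : Type) [Field k] (m p : ℕ) : (Fin (m + p) → k) ≃ₗ[k] (Fin m → k) × (Fin p → k) :=
  (LinearEquiv.funCongrLeft k k finSumFinEquiv).trans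
    (LinearEquiv.sumArrowLequivProdArrow _ _ k k)

/-- Direct sum of two representations. -/
def dSum {Λ : Fin n → Fin n → ℕ} (M N : Rep k n Λ) : Rep k n Λ where
  d x := M.d x + N.d x
  f a b i :=
    (splitL k (M.d b) (N.d b)).symm.toLinearMap ∘ₗ
      (LinearMap.prodMap (M.f a b i) (N.f a b i)) ∘ₗ (splitL k (M.d a) (N.d a)).toLinearMap

/-- The zero representation (as an object). -/
def zeroRep (k : Type) [Field k] (n : ℕ) (Λ : Fin n → Fin n → ℕ) : Rep k n Λ where
  d _ := 0
  f _ _ _ := 0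

/-- Direct sum of a list of representations. -/
def dSumList {Λ : Fin n → Fin n → ℕ} (L : List (Rep k n Λ)) : Rep k n Λ :=
  L.foldr dSum (zeroRep k n Λ)

/-- `M` is indecomposable. -/
def Indecomp {Λ : Fin n → Fin n → ℕ} (M : Rep k n Λ) : Prop :=
  ¬ IsZeroRep M ∧ ∀ A B : Rep k n Λ, RepIso M (dSum A B) → IsZeroRep A ∨ IsZeroRep B

/-- `X` is a direct summand of `M`. -/
def IsSummand {Λ : Fin n → Fin n → ℕ} (X M : Rep k n Λ) : Prop :=
  ∃ Y, RepIso M (dSum X Y)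

/-! ### Reflection functors (on objects) -/

/-- Index type of the arrows ending at `x`. -/
abbrev Arin {n : ℕ} (Λ : Fin n → Fin n → ℕ) (x : Fin n) := Σ y : Fin n, Fin (Λ y x)

/-- Index type of the arrows starting at `x`. -/
abbrev Aout {n : ℕ} (Λ : Fin n → Fin n → ℕ) (x : Fin n) := Σ y : Fin n, Fin (Λ x y)

/-- The map `h : ⊕_{a : y → x} V(y) → V(x)` induced by the maps along the arrows ending at `x`. -/
noncomputable def inMap (Λ : Fin n → Fin n → ℕ) (M : Rep k n Λ) (x : Fin n) :
    ((p : Arin Λ x) → (Fin (M.d p.1) → k)) →ₗ[k] (Fin (M.d x) → k) :=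
  ∑ p : Arin Λ x, (M.f p.1 x p.2) ∘ₗ LinearMap.proj p

/-- The map `h' : V(x) → ⊕_{a : x → y} V(y)` induced by the maps along arrows starting at `x`. -/
def outMap (Λ : Fin n → Fin n → ℕ) (M : Rep k n Λ) (x : Fin n) :
    (Fin (M.d x) → k) →ₗ[k] ((p : Aout Λ x) → (Fin (M.d p.1) → k)) :=
  LinearMap.pi fun p => M.f x p.1 p.2

noncomputable def kerEquiv (Λ : Fin n → Fin n → ℕ) (M : Rep k n Λ) (x : Fin n) :
    LinearMap.ker (inMap Λ M x) ≃ₗ[k]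
      (Fin (Module.finrank k (LinearMap.ker (inMap Λ M x))) → k) :=
  (Module.finBasis k _).equivFun

noncomputable def cokerEquiv (Λ : Fin n → Fin n → ℕ) (M : Rep k n Λ) (x : Fin n) :
    (((p : Aout Λ x) → (Fin (M.d p.1) → k)) ⧸ LinearMap.range (outMap Λ M x)) ≃ₗ[k]
      (Fin (Module.finrank k (((p : Aout Λ x) → (Fin (M.d p.1) → k)) ⧸
        LinearMap.range (outMap Λ M x))) → k) :=
  (Module.finBasis k _).equivFun

/-- The positive reflection functor `F_x⁺` (on objects): the space at `x` is replaced
by the kernel of `inMap`, with the maps along the reversed arrows induced by inclusion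
followed by the projections. -/
noncomputable def reflPlus (x : Fin n) (Λ : Fin n → Fin n → ℕ) (M : Rep k n Λ) :
    Rep k n (flipO x Λ) where
  d z := if z = x then Module.finrank k (LinearMap.ker (inMap Λ M x)) else M.d z
  f a b i :=
    if ha : a = x then
      if hb : b = x then 0
      else
        (castL k (if_neg hb).symm).toLinearMap ∘ₗ
          (LinearMap.proj (φ := fun p : Arin Λ x => Fin (M.d p.1) → k)
            (⟨b, Fin.cast (by subst ha; simp [flipO]) i⟩ : Arin Λ x)) ∘ₗ
          (LinearMap.ker (inMap Λ M x)).subtype ∘ₗ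
          (kerEquiv Λ M x).symm.toLinearMap ∘ₗ (castL k (if_pos ha)).toLinearMap
    else
      if hb : b = x then 0
      else
        (castL k (if_neg hb).symm).toLinearMap ∘ₗ
          M.f a b (Fin.cast (by simp [flipO, ha, hb]) i) ∘ₗ
          (castL k (if_neg ha)).toLinearMap

/-- The negative reflection functor `F_x⁻` (on objects), presented as a map from
representations of `(Γ, σ_x Λ)` to representations of `(Γ, Λ)`: the space at `x` is
replaced by the cokernel of `outMap`. -/
noncomputable def reflMinus (x : Fin n) (Λ : Fin n → Fin n → ℕ)
    (N : Rep k n (flipO x Λ)) : Rep k n Λ where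
  d z := if z = x then
      Module.finrank k (((p : Aout (flipO x Λ) x) → (Fin (N.d p.1) → k)) ⧸
        LinearMap.range (outMap (flipO x Λ) N x))
    else N.d z
  f a b i :=
    if hb : b = x then
      if ha : a = x then 0
      else
        (castL k (if_pos hb).symm).toLinearMap ∘ₗ
          (cokerEquiv (flipO x Λ) N x).toLinearMap ∘ₗ
          (LinearMap.range (outMap (flipO x Λ) N x)).mkQ ∘ₗ
          (LinearMap.single k (fun p : Aout (flipO x Λ) x => Fin (N.d p.1) → k)
            (⟨a, Fin.cast (by subst hb; simp [flipO]) i⟩ : Aout (flipO x Λ) x)) ∘ₗ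
          (castL k (if_neg ha)).toLinearMap
    else
      if ha : a = x then 0
      else
        (castL k (if_neg hb).symm).toLinearMap ∘ₗ
          N.f a b (Fin.cast (by simp [flipO, ha, hb]) i) ∘ₗ
          (castL k (if_neg ha)).toLinearMap

/-- `F(S) = F_{x_s}⁺ ⋯ F_{x_1}⁺` applied to a representation. -/
noncomputable def FList : (S : List (Fin n)) → (Λ : Fin n → Fin n → ℕ) → Rep k n Λ →
    Rep k n (orientAfter Λ S)
  | [], _, M => M
  | x :: xs, Λ, M => FList xs (flipO x Λ) (reflPlus x Λ M)

/-- `S` annihilates `M` : `F(S) M = 0`. -/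
def Annihilates (Λ : Fin n → Fin n → ℕ) (S : List (Fin n)) (M : Rep k n Λ) : Prop :=
  IsZeroRep (FList S Λ M)

/-- `M` is preprojective: some `(+)`-admissible sequence annihilates it. -/
def Preprojective (Λ : Fin n → Fin n → ℕ) (M : Rep k n Λ) : Prop :=
  ∃ S, Admissible Λ S ∧ Annihilates Λ S M

/-- `S` is a shortest `(+)`-admissible sequence annihilating `M` : it annihilates `M` and no
proper subsequence of `S` annihilates `M`.  (This predicate is invariant under `∼`, so it
expresses `S ∼ S_M`.) -/
def IsShortestAnn (Λ : Fin n → Fin n → ℕ) (M : Rep k n Λ) (S : List (Fin n)) : Prop :=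
  Admissible Λ S ∧ Annihilates Λ S M ∧
  ∀ S', Admissible Λ S' → Annihilates Λ S' M → Preceq Λ S' S → Sim (edges Λ) S' S

/-- The simple representation `L_x` concentrated at the vertex `x`. -/
def simpleRep (Λ : Fin n → Fin n → ℕ) (x : Fin n) : Rep k n Λ where
  d z := if z = x then 1 else 0
  f _ _ _ := 0

/-- `M(S) = F_{x₁}⁻ F_{x₂}⁻ ⋯ F_{x_{s-1}}⁻ (L_{x_s})`, where `L_{x_s}` is the simple
(projective) module over `k(Γ, σ_{x_{s-1}} ⋯ σ_{x_1} Λ)` at the vertex `x_s`. -/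
noncomputable def Mof : (Λ : Fin n → Fin n → ℕ) → (S : List (Fin n)) → Rep k n Λ
  | Λ, [] => zeroRep k n Λ
  | Λ, [x] => simpleRep Λ x
  | Λ, x :: y :: ys => reflMinus x Λ (Mof (flipO x Λ) (y :: ys))

variable {n : ℕ}

/-! ## The Weyl group -/

/-- The simple reflection `σ_i` attached to a generalized Cartan matrix `A`,
as a linear endomorphism of `ℤⁿ` : `σ_i(v) = v - (∑ l, a_{il} v_l) e_i`. -/
def sigmaL (A : Fin n → Fin n → ℤ) (i : Fin n) : (Fin n → ℤ) →ₗ[ℤ] (Fin n → ℤ) where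
  toFun v := v - (∑ l, A i l * v l) • Pi.single i 1
  map_add' v w := by
    simp only [Pi.add_apply, mul_add, Finset.sum_add_distrib, add_smul]
    abel
  map_smul' c v := by
    simp only [Pi.smul_apply, smul_eq_mul, RingHom.id_apply, smul_sub]
    congr 1
    rw [smul_smul, Finset.mul_sum]
    congr 1
    exact Finset.sum_congr rfl fun l _ => by ring

theorem sigma_invol (A : Fin n → Fin n → ℤ) (hA : ∀ i, A i i = 2) (i : Fin n) :
    (sigmaL A i).comp (sigmaL A i) = LinearMap.id := by
  apply LinearMap.ext
  intro v
  simp only [LinearMap.comp_apply, LinearMap.id_apply, sigmaL, LinearMap.coe_mk, AddHom.coe_mk]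
  set c := ∑ l, A i l * v l with hc
  set s : Fin n → ℤ := Pi.single i 1 with hs
  have h1 : ∑ l, A i l * (v - c • s) l = -c := by
    have h2 : ∀ l, A i l * (v - c • s) l = A i l * v l - c * (A i l * s l) := fun l => by
      simp only [Pi.sub_apply, Pi.smul_apply, smul_eq_mul]
      ring
    rw [Finset.sum_congr rfl fun l _ => h2 l, Finset.sum_sub_distrib, ← Finset.mul_sum]
    have h3 : ∑ l, A i l * s l = 2 := by
      rw [Finset.sum_eq_single i]
      · simp [hs, hA i]
      · intro b _ hb
        simp [hs, Pi.single_eq_of_ne hb]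
      · simp
    rw [h3, ← hc]
    ring
  rw [h1]
  ext j
  simp only [Pi.sub_apply, Pi.smul_apply, smul_eq_mul]
  ring

/-- The simple reflection `σ_i` as an automorphism of `ℤⁿ`. -/
def sigmaE (A : Fin n → Fin n → ℤ) (hA : ∀ i, A i i = 2) (i : Fin n) :
    (Fin n → ℤ) ≃ₗ[ℤ] (Fin n → ℤ) :=
  LinearEquiv.ofLinear (sigmaL A i) (sigmaL A i) (sigma_invol A hA i) (sigma_invol A hA i)

/-- The length `ℓ(w)`: the least `l ≥ 0` such that `w` is a product of `l` simple
reflections. -/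
noncomputable def wordLen (A : Fin n → Fin n → ℤ) (hA : ∀ i, A i i = 2)
    (w : (Fin n → ℤ) ≃ₗ[ℤ] (Fin n → ℤ)) : ℕ :=
  sInf {l | ∃ ys : List (Fin n), ys.length = l ∧ w = (ys.map (sigmaE A hA)).prod}

/-- The word `w(S) = σ_{x_s} ⋯ σ_{x_1}` associated to a sequence `S = x₁, …, x_s`. -/
def wordOf (A : Fin n → Fin n → ℤ) (hA : ∀ i, A i i = 2) (S : List (Fin n)) :
    (Fin n → ℤ) ≃ₗ[ℤ] (Fin n → ℤ) :=
  ((S.reverse).map (sigmaE A hA)).prod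

/-- The symmetric generalized Cartan matrix of the underlying graph of `(Γ, Λ)`. -/
def cartanOf (Λ : Fin n → Fin n → ℕ) : Fin n → Fin n → ℤ :=
  fun i j => if i = j then 2 else -(edges Λ i j : ℤ)

theorem cartan_diag (Λ : Fin n → Fin n → ℕ) : ∀ i, cartanOf Λ i i = 2 := by
  intro i; simp [cartanOf]

/-- The simple reflections of the Weyl group of the underlying graph of `(Γ, Λ)`. -/
def wSig (Λ : Fin n → Fin n → ℕ) : Fin n → ((Fin n → ℤ) ≃ₗ[ℤ] (Fin n → ℤ)) :=
  sigmaE (cartanOf Λ) (cartan_diag Λ)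

/-- `w(S)` for a sequence of vertices of `(Γ, Λ)`. -/
def wordOfSeq (Λ : Fin n → Fin n → ℕ) (S : List (Fin n)) :
    (Fin n → ℤ) ≃ₗ[ℤ] (Fin n → ℤ) :=
  ((S.reverse).map (wSig Λ)).prod

/-- The word `w(S)` is reduced: `ℓ(w(S))` equals the number of letters of `S`. -/
noncomputable def IsReducedSeq (Λ : Fin n → Fin n → ℕ) (S : List (Fin n)) : Prop :=
  wordLen (cartanOf Λ) (cartan_diag Λ) (wordOfSeq Λ S) = S.length

/-! ## Dynkin graphs of types A, D, E -/

def edgeA (n : ℕ) : Fin n → Fin n → ℕ := fun i j =>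
  if (i : ℕ) + 1 = (j : ℕ) ∨ (j : ℕ) + 1 = (i : ℕ) then 1 else 0

def edgeD (n : ℕ) : Fin n → Fin n → ℕ := fun i j =>
  if ((i : ℕ) = 0 ∧ (j : ℕ) = 2) ∨ ((j : ℕ) = 0 ∧ (i : ℕ) = 2) ∨
     ((i : ℕ) = 1 ∧ (j : ℕ) = 2) ∨ ((j : ℕ) = 1 ∧ (i : ℕ) = 2) ∨
     (2 ≤ (i : ℕ) ∧ (i : ℕ) + 1 = (j : ℕ)) ∨ (2 ≤ (j : ℕ) ∧ (j : ℕ) + 1 = (i : ℕ))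
  then 1 else 0

def edgeE (n : ℕ) : Fin n → Fin n → ℕ := fun i j =>
  if ((i : ℕ) + 1 = (j : ℕ) ∧ (j : ℕ) ≤ n - 2) ∨ ((j : ℕ) + 1 = (i : ℕ) ∧ (i : ℕ) ≤ n - 2) ∨
     ((i : ℕ) = 2 ∧ (j : ℕ) = n - 1) ∨ ((j : ℕ) = 2 ∧ (i : ℕ) = n - 1)
  then 1 else 0

/-- The underlying graph (given by its edge-count function `E`) is a Dynkin diagram of
type `A`, `D`, or `E`. -/
def IsDynkinADE (n : ℕ) (E : Fin n → Fin n → ℕ) : Prop :=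
  ∃ e : Fin n ≃ Fin n,
    (∀ i j, E i j = edgeA n (e i) (e j)) ∨
    (4 ≤ n ∧ ∀ i j, E i j = edgeD n (e i) (e j)) ∨
    ((n = 6 ∨ n = 7 ∨ n = 8) ∧ ∀ i j, E i j = edgeE n (e i) (e j))

/-! ## Coxeter-sortable elements -/

/-- Lexicographic comparison of index tuples. -/
def lexLE {s : ℕ} (ι ι' : Fin s → ℕ) : Prop :=
  ι = ι' ∨ ∃ j, (∀ j', j' < j → ι j' = ι' j') ∧ ι j < ι' j

/-- `w` is `c`-sortable for the Coxeter element determined by the half-infinite word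
`cseq` (with dividers every `blockLen` letters): the lexicographically first subsequence
of `cseq` that is a reduced word for `w` defines a sequence of subsets (between adjacent
dividers) that is decreasing under inclusion. -/
def CSortable (A : Fin n → Fin n → ℤ) (hA : ∀ i, A i i = 2) (cseq : ℕ → Fin n)
    (blockLen : ℕ) (w : (Fin n → ℤ) ≃ₗ[ℤ] (Fin n → ℤ)) : Prop :=
  ∃ (s : ℕ) (ι : Fin s → ℕ), StrictMono ι ∧
    w = ((List.ofFn fun j => cseq (ι j)).map (sigmaE A hA)).prod ∧
    wordLen A hA w = s ∧
    (∀ ι' : Fin s → ℕ, StrictMono ι' →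
      w = ((List.ofFn fun j => cseq (ι' j)).map (sigmaE A hA)).prod → lexLE ι ι') ∧
    ∀ m : ℕ, {a : Fin n | ∃ j, (ι j) / blockLen = m + 1 ∧ cseq (ι j) = a} ⊆
             {a : Fin n | ∃ j, (ι j) / blockLen = m ∧ cseq (ι j) = a}


/-- A nonzero non-isomorphism between representations. -/
def RepStep {k : Type} [Field k] {n : ℕ} {Λ : Fin n → Fin n → ℕ} (X Y : Rep k n Λ) : Prop :=
  ∃ f : RepHom X Y, (∃ x v, f.g x v ≠ 0) ∧ ¬ ∀ x, Function.Bijective (f.g x)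

/-- `v` is a minimal element of `D` in the poset `(Γ₀, Λ)`. -/
def MinimalIn {n : ℕ} (Λ : Fin n → Fin n → ℕ) (D : Set (Fin n)) (v : Fin n) : Prop :=
  v ∈ D ∧ ∀ u ∈ D, PathLE Λ u v → u = v

/-- The pairs `(h, v)` of Proposition 3.2(a): `0 < h ≤ r` and `v` a minimal element of
`Supp S_h \ H_Λ(Supp S_{h+1})` (with `Supp S_{r+1} = ∅`). -/
def JoinPair {n : ℕ} (Λ : Fin n → Fin n → ℕ) (segs : List (List (Fin n)))
    (p : ℕ × Fin n) : Prop :=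
  0 < p.1 ∧ p.1 ≤ segs.length ∧
  MinimalIn Λ (suppOf (segs.getD (p.1 - 1) []) \ hull Λ (suppOf (segs.getD p.1 []))) p.2

/-! ## Combinatorics of admissible sequences -/

/-- No loops and no 2-cycles. -/
def Simp (Λ : Fin n → Fin n → ℕ) : Prop := ∀ a b, Λ a b = 0 ∨ Λ b a = 0

theorem Simp.flip {Λ : Fin n → Fin n → ℕ} (h : Simp Λ) (x : Fin n) : Simp (flipO x Λ) := by
  intro a b
  have := h a b
  simp only [flipO]
  split_ifs <;> tauto

theorem edges_flip (Λ : Fin n → Fin n → ℕ) (x : Fin n) : edges (flipO x Λ) = edges Λ := by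
  funext a b
  simp only [edges, flipO]
  by_cases ha : a = x <;> by_cases hb : b = x <;> simp [ha, hb, add_comm]

theorem flip_comm (Λ : Fin n → Fin n → ℕ) (x y : Fin n) (h1 : Λ x y = 0) (h2 : Λ y x = 0) :
    flipO x (flipO y Λ) = flipO y (flipO x Λ) := by
  funext a b
  by_cases hax : a = x <;> by_cases hbx : b = x <;> by_cases hay : a = y <;>
    by_cases hby : b = y <;> simp_all [flipO]

/-- Compatibility of a count function with an orientation. -/
def Compat (Λ : Fin n → Fin n → ℕ) (c : Fin n → ℕ) : Prop :=
  ∀ x y, Λ x y ≠ 0 → c x ≤ c y ∧ c y ≤ c x + 1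

theorem Admissible.compat {Λ : Fin n → Fin n → ℕ} (hs : Simp Λ) {S : List (Fin n)}
    (hS : Admissible Λ S) : Compat Λ (fun v => S.count v) := by
  induction S generalizing Λ with
  | nil => intro x y _; simp
  | cons z S ih =>
    obtain ⟨hz, hS⟩ := hS
    have ih := ih (hs.flip z) hS
    intro x y hxy
    have hxz : x ≠ z := by rintro rfl; exact hxy (hz y)
    by_cases hyz : y = z
    · subst hyz
      have := ih y x (by simpa [flipO] using hxy)
      simp only [List.count_cons_self, List.count_cons_of_ne hxz.symm] at this ⊢
      omega
    · have := ih x y (by simpa [flipO, hxz, hyz] using hxy)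
      simpa [List.count_cons_of_ne hxz.symm, List.count_cons_of_ne (Ne.symm hyz)] using this

theorem admissible_of_prefix {Λ : Fin n → Fin n → ℕ} (hs : Simp Λ) {S : List (Fin n)}
    (h : ∀ P, P <+: S → Compat Λ (fun v => P.count v)) : Admissible Λ S := by
  induction S generalizing Λ with
  | nil => trivial
  | cons z S ih =>
    have hz : IsSink Λ z := by
      intro y
      by_contra hy
      have hzy : z ≠ y := by
        rintro rfl
        have := hs z z
        tauto
      have := h [z] (by simp) z y hy
      simp [List.count_cons_of_ne hzy] at this
    refine ⟨hz, ih (hs.flip z) ?_⟩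
    intro P hP x y hxy
    have hc := h (z :: P) (by simpa using hP)
    by_cases hyz : y = z
    · subst hyz
      exact absurd (hz x) (by simpa [flipO] using hxy)
    by_cases hxz : x = z
    · subst hxz
      have := hc y x (by simpa [flipO] using hxy)
      simp only [List.count_cons_self, List.count_cons_of_ne (Ne.symm hyz)] at this ⊢
      omega
    · have := hc x y (by simpa [flipO, hxz, hyz] using hxy)
      simpa [List.count_cons_of_ne (Ne.symm hxz), List.count_cons_of_ne (Ne.symm hyz)] using this

theorem Sim.cons {E : Fin n → Fin n → ℕ} {S T : List (Fin n)} (h : Sim E S T) (z : Fin n) :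
    Sim E (z :: S) (z :: T) := by
  induction h with
  | refl => exact Relation.ReflTransGen.refl
  | tail _ h2 ih =>
    refine ih.tail ?_
    cases h2 with
    | swap l₁ l₂ a b h => exact SwapRel.swap (z :: l₁) l₂ a b h

theorem Sim.perm {E : Fin n → Fin n → ℕ} {S T : List (Fin n)} (h : Sim E S T) : S.Perm T := by
  induction h with
  | refl => exact List.Perm.refl _
  | tail _ h2 ih =>
    refine ih.trans ?_
    cases h2 with
    | swap l₁ l₂ a b h => exact List.Perm.append_left _ (List.Perm.swap _ _ _)

theorem Sim.swap2 {E : Fin n → Fin n → ℕ} (l : List (Fin n)) (a b : Fin n) (h : E a b = 0) :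
    Sim E (a :: b :: l) (b :: a :: l) :=
  Relation.ReflTransGen.single (SwapRel.swap [] l a b h)

theorem sink_flip {Λ : Fin n → Fin n → ℕ} {x z : Fin n} (hx : IsSink Λ x) (hz : IsSink Λ z)
    (hne : x ≠ z) : IsSink (flipO z Λ) x := by
  intro y
  simp only [flipO]
  split_ifs with h
  · rcases h with h | h
    · exact absurd h hne
    · subst h; exact hz x
  · exact hx y

theorem front {Λ : Fin n → Fin n → ℕ} {T : List (Fin n)} {x : Fin n}
    (hT : Admissible Λ T) (hx : IsSink Λ x) (hm : x ∈ T) :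
    Admissible (flipO x Λ) (T.erase x) ∧ Sim (edges Λ) T (x :: T.erase x) := by
  induction T generalizing Λ with
  | nil => simp at hm
  | cons z T ih =>
    obtain ⟨hz, hT⟩ := hT
    by_cases hzx : z = x
    · subst hzx
      simp only [List.erase_cons_head]
      exact ⟨hT, Relation.ReflTransGen.refl⟩
    · have hm' : x ∈ T := by simpa [Ne.symm hzx] using hm
      obtain ⟨h1, h2⟩ := ih hT (sink_flip hx hz (Ne.symm hzx)) hm'
      rw [List.erase_cons_tail (by simpa using hzx)]
      refine ⟨⟨sink_flip hz hx hzx, ?_⟩, ?_⟩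
      · rw [flip_comm Λ z x (hz x) (hx z)]; exact h1
      · rw [edges_flip] at h2
        exact (h2.cons z).trans (Sim.swap2 _ _ _ (by simp [edges, hz x, hx z]))

theorem preceq_of_count {Λ : Fin n → Fin n → ℕ} {S T : List (Fin n)} (hS : Admissible Λ S)
    (hT : Admissible Λ T) (h : ∀ v, S.count v ≤ T.count v) : Preceq Λ S T := by
  induction S generalizing Λ T with
  | nil => exact ⟨T, hT, Relation.ReflTransGen.refl⟩
  | cons x S ih =>
    obtain ⟨hx, hS⟩ := hS
    have hm : x ∈ T := by
      have := h x
      rw [List.count_cons_self] at this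
      exact List.count_pos_iff.1 (by omega)
    obtain ⟨h1, h2⟩ := front hT hx hm
    obtain ⟨U, hU, hsim⟩ := ih hS h1 (by
      intro v
      have := h v
      rw [h2.perm.count_eq v] at this
      simp only [List.count_cons] at this
      omega)
    rw [edges_flip] at hsim
    exact ⟨U, hU, h2.trans (hsim.cons x)⟩

theorem sim_of_count {Λ : Fin n → Fin n → ℕ} {S T : List (Fin n)} (hS : Admissible Λ S)
    (hT : Admissible Λ T) (h : ∀ v, S.count v = T.count v) : Sim (edges Λ) T S := by
  obtain ⟨U, _, hU⟩ := preceq_of_count hS hT (fun v => (h v).le)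
  have : U = [] := by
    have h1 := hU.perm.length_eq
    have h2 := (List.perm_iff_count.2 h).length_eq
    rw [List.length_append] at h1
    exact List.length_eq_zero_iff.1 (by omega)
  simpa [this] using hU

theorem Preceq.count {Λ : Fin n → Fin n → ℕ} {S T : List (Fin n)} (h : Preceq Λ S T) (v : Fin n) :
    S.count v ≤ T.count v := by
  obtain ⟨U, _, hU⟩ := h
  rw [hU.perm.count_eq v, List.count_append]
  omega

/-- Topological sort. -/
theorem exists_topo (Λ : Fin n → Fin n → ℕ)
    (hacyc : ∀ a : Fin n, ¬ Relation.TransGen (fun u v => Λ u v ≠ 0) a a) :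
    ∃ L : List (Fin n), L.Nodup ∧ (∀ v, v ∈ L) ∧
      ∀ P, P <+: L → ∀ x y, Λ x y ≠ 0 → x ∈ P → y ∈ P := by
  classical
  let h : Fin n → ℕ := fun x =>
    (Finset.univ.filter fun z => Relation.TransGen (fun u v => Λ u v ≠ 0) x z).card
  have hh : ∀ x y, Λ x y ≠ 0 → h y < h x := by
    intro x y hxy
    apply Finset.card_lt_card
    refine ⟨fun z hz => ?_, fun hsub => ?_⟩
    · simp only [Finset.mem_filter, Finset.mem_univ, true_and] at hz ⊢
      exact Relation.TransGen.head hxy hz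
    · have : y ∈ Finset.univ.filter fun z => Relation.TransGen (fun u v => Λ u v ≠ 0) x z := by
        simp only [Finset.mem_filter, Finset.mem_univ, true_and]
        exact Relation.TransGen.single hxy
      have := hsub this
      simp only [Finset.mem_filter, Finset.mem_univ, true_and] at this
      exact hacyc y this
  let r : Fin n → Fin n → Prop := fun a b => h a ≤ h b
  have : Std.Total r := ⟨fun a b => le_total (h a) (h b)⟩
  have : IsTrans (Fin n) r := ⟨fun a b c => le_trans⟩
  let L := (List.finRange n).insertionSort r
  have hp : L.Perm (List.finRange n) := List.perm_insertionSort r _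
  have hsort : L.Pairwise r := List.pairwise_insertionSort r _
  refine ⟨L, hp.nodup_iff.2 (List.nodup_finRange n), fun v => hp.mem_iff.2 (List.mem_finRange v), ?_⟩
  rintro P ⟨Q, hQ⟩ x y hxy hx
  have hy : y ∈ L := hp.mem_iff.2 (List.mem_finRange y)
  rw [← hQ] at hy hsort
  rcases List.mem_append.1 hy with hy | hy
  · exact hy
  · have := (List.pairwise_append.1 hsort).2.2 x hx y hy
    exact absurd (hh x y hxy) (not_lt.2 this)

theorem count_segs (L : List (Fin n)) (hn : L.Nodup) (hm : ∀ v, v ∈ L) (c : Fin n → ℕ) (j : ℕ)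
    (v : Fin n) :
    ((List.range j).map (fun i => L.filter (fun u => decide (i < c u)))).flatten.count v
      = min j (c v) := by
  induction j with
  | zero => simp
  | succ j ih =>
    rw [List.range_succ, List.map_append, List.flatten_append, List.count_append, ih]
    simp only [List.map_cons, List.map_nil, List.flatten_cons, List.flatten_nil, List.append_nil]
    by_cases h : j < c v
    · rw [List.count_filter (by simpa using h), List.count_eq_one_of_mem hn (hm v)]
      omega
    · rw [List.count_eq_zero_of_not_mem (by simp [h])]
      omega

theorem prefix_flatten_range (f : ℕ → List (Fin n)) (r : ℕ) (P : List (Fin n))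
    (h : P <+: ((List.range r).map f).flatten) :
    P = [] ∨ ∃ j Q, Q <+: f j ∧ P = ((List.range j).map f).flatten ++ Q := by
  induction r with
  | zero => left; simpa using h
  | succ r ih =>
    rw [List.range_succ, List.map_append, List.flatten_append] at h
    simp only [List.map_cons, List.map_nil, List.flatten_cons, List.flatten_nil,
      List.append_nil] at h
    obtain ⟨R, hR⟩ := h
    rcases List.append_eq_append_iff.1 hR with ⟨Q, h1, _⟩ | ⟨Q, h1, h2⟩
    · exact ih ⟨Q, h1.symm⟩
    · exact Or.inr ⟨r, Q, ⟨R, h2.symm⟩, h1⟩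

theorem exists_segs {Λ : Fin n → Fin n → ℕ} (hs : Simp Λ)
    (hacyc : ∀ a : Fin n, ¬ Relation.TransGen (fun u v => Λ u v ≠ 0) a a)
    (c : Fin n → ℕ) (hc : Compat Λ c) :
    ∃ segs : List (List (Fin n)), Admissible Λ segs.flatten ∧
      (∀ v, segs.flatten.count v = c v) ∧
      (∀ seg ∈ segs, seg ≠ [] ∧ seg.Nodup) ∧
      (∀ i, suppOf (segs.getD i []) = {v | i < c v}) ∧
      (∀ i, suppOf ((segs.drop i).flatten) = {v | i < c v}) := by
  obtain ⟨L, hL, hm, hpre⟩ := exists_topo Λ hacyc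
  set f : ℕ → List (Fin n) := fun i => L.filter (fun u => decide (i < c u)) with hf
  set r := Finset.univ.sup c with hr
  have hcr : ∀ v, c v ≤ r := fun v => Finset.le_sup (Finset.mem_univ v)
  refine ⟨(List.range r).map f, ?_, ?_, ?_, ?_, ?_⟩
  · apply admissible_of_prefix hs
    intro P hP x y hxy
    rcases prefix_flatten_range f r P hP with rfl | ⟨j, Q, hQ, rfl⟩
    · simp
    · simp only [List.count_append, hf, count_segs L hL hm]
      obtain ⟨L1, hL1, rfl⟩ : ∃ L1, L1 <+: L ∧ Q = L1.filter (fun u => decide (j < c u)) := by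
        obtain ⟨Q', hQ'⟩ := hQ
        obtain ⟨l1, l2, h1, h2, _⟩ := List.filter_eq_append_iff.1 hQ'.symm
        exact ⟨l1, ⟨l2, h1.symm⟩, h2.symm⟩
      have h1 := hc x y hxy
      have hnd : L1.Nodup := hL.sublist hL1.sublist
      have hle : ∀ v, (L1.filter (fun u => decide (j < c u))).count v
          = if j < c v ∧ v ∈ L1 then 1 else 0 := by
        intro v
        split_ifs with h
        · exact List.count_eq_one_of_mem (hnd.filter _) (by simp [h.1, h.2])
        · exact List.count_eq_zero_of_not_mem (by
            rw [List.mem_filter]; simp only [decide_eq_true_eq]; tauto)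
      rw [hle x, hle y]
      have := hpre L1 hL1 x y hxy
      split_ifs with h2 h3 h3
      · omega
      · exact absurd ⟨by omega, this h2.2⟩ h3
      · omega
      · by_cases hx : j < c x <;> omega
  · intro v
    rw [hf, count_segs L hL hm, min_eq_right (hcr v)]
  · intro seg hseg
    obtain ⟨i, hi, rfl⟩ := List.mem_map.1 hseg
    refine ⟨?_, hL.filter _⟩
    have hi : i < r := List.mem_range.1 hi
    obtain ⟨v, _, hv⟩ := Finset.lt_sup_iff.1 hi
    exact List.ne_nil_of_mem (List.mem_filter.2 ⟨hm v, by simpa using hv⟩)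
  · intro i
    ext v
    by_cases hi : i < r
    · simp [suppOf, List.getD, hi, hf, hm]
    · have := hcr v
      simp only [suppOf, Set.mem_ofPred_eq, List.getD, List.getElem?_map]
      rw [List.getElem?_eq_none (by simpa using hi)]
      simp; omega
  · intro i
    ext v
    simp only [suppOf, Set.mem_ofPred_eq, List.mem_flatten]
    constructor
    · rintro ⟨l, hl, hv⟩
      obtain ⟨j, hj, rfl⟩ := List.mem_iff_getElem.1 hl
      simp [hf] at hv
      omega
    · intro hv
      have : i < r := lt_of_lt_of_le hv (hcr v)
      refine ⟨f i, ?_, by simpa [hf, hm] using hv⟩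
      exact List.mem_iff_getElem.2 ⟨0, by simpa using this, by simp⟩

theorem exists_canon {Λ : Fin n → Fin n → ℕ} (hs : Simp Λ)
    (hacyc : ∀ a : Fin n, ¬ Relation.TransGen (fun u v => Λ u v ≠ 0) a a)
    {S : List (Fin n)} (hS : Admissible Λ S) :
    ∃ segs, Segments Λ S segs ∧ ∀ i, suppOf (segs.getD i []) = {v | i < S.count v} := by
  obtain ⟨segs, h1, h2, h3, h4, h5⟩ := exists_segs hs hacyc _ (hS.compat hs)
  exact ⟨segs, ⟨h1, sim_of_count h1 hS h2, h3, fun i _ => (h4 i).trans (h5 i).symm⟩, h4⟩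

theorem isJoin_of_count {Λ : Fin n → Fin n → ℕ} (hs : Simp Λ)
    (hacyc : ∀ a : Fin n, ¬ Relation.TransGen (fun u v => Λ u v ≠ 0) a a)
    {S T J : List (Fin n)} (hS : Admissible Λ S) (hT : Admissible Λ T) (hJ : Admissible Λ J)
    (h : ∀ v, J.count v = max (S.count v) (T.count v)) : IsJoin Λ S T J := by
  obtain ⟨CS, h1, h1'⟩ := exists_canon hs hacyc hS
  obtain ⟨CT, h2, h2'⟩ := exists_canon hs hacyc hT
  obtain ⟨CJ, h3, h3'⟩ := exists_canon hs hacyc hJ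
  refine ⟨CS, CT, CJ, h1, h2, h3, fun i => ?_⟩
  rw [h1', h2', h3']
  ext v
  simp [h v]

/-- Pointwise maximum of the counts. -/
def maxCount (Ts : List (List (Fin n))) (v : Fin n) : ℕ :=
  Ts.foldr (fun T m => max (T.count v) m) 0

theorem exists_max {Λ : Fin n → Fin n → ℕ} (hs : Simp Λ)
    (hacyc : ∀ a : Fin n, ¬ Relation.TransGen (fun u v => Λ u v ≠ 0) a a)
    (Ts : List (List (Fin n))) (h : ∀ T ∈ Ts, Admissible Λ T) :
    ∃ J, Admissible Λ J ∧ ∀ v, J.count v = maxCount Ts v := by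
  have hc : Compat Λ (maxCount Ts) := by
    induction Ts with
    | nil => intro x y _; simp [maxCount]
    | cons T Ts ih =>
      intro x y hxy
      have h1 := ih (fun T hT => h T (by simp [hT])) x y hxy
      have h2 := (h T (by simp)).compat hs x y hxy
      simp only [maxCount, List.foldr_cons] at h1 h2 ⊢
      omega
  obtain ⟨segs, h1, h2, _⟩ := exists_segs hs hacyc _ hc
  exact ⟨_, h1, h2⟩

theorem isJoinList_of_count {Λ : Fin n → Fin n → ℕ} (hs : Simp Λ)
    (hacyc : ∀ a : Fin n, ¬ Relation.TransGen (fun u v => Λ u v ≠ 0) a a)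
    (Ts : List (List (Fin n))) (h : ∀ T ∈ Ts, Admissible Λ T) (S : List (Fin n))
    (hS : Admissible Λ S) (hc : ∀ v, S.count v = maxCount Ts v) : IsJoinList Λ Ts S := by
  induction Ts generalizing S with
  | nil =>
    refine List.eq_nil_iff_forall_not_mem.2 fun v hv => ?_
    have := List.count_pos_iff.2 hv
    rw [hc v] at this
    simp [maxCount] at this
  | cons T Ts ih =>
    obtain ⟨J, hJ, hJc⟩ := exists_max hs hacyc Ts (fun T hT => h T (by simp [hT]))
    refine ⟨J, ih (fun T hT => h T (by simp [hT])) J hJ hJc,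
      isJoin_of_count hs hacyc (h T (by simp)) hJ hS fun v => ?_⟩
    rw [hc v, hJc v]
    rfl

/-! ## Reflection functors -/

/-- Transport away from the reflected vertex. -/
noncomputable def up (x : Fin n) {Λ : Fin n → Fin n → ℕ} (M : Rep k n Λ) (z : Fin n) :
    (Fin (M.d z) → k) →ₗ[k] (Fin ((reflPlus x Λ M).d z) → k) :=
  if h : z = x then 0 else (castL k (if_neg h).symm).toLinearMap

/-- Inverse transport away from the reflected vertex. -/
noncomputable def dn (x : Fin n) {Λ : Fin n → Fin n → ℕ} (M : Rep k n Λ) (z : Fin n) :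
    (Fin ((reflPlus x Λ M).d z) → k) →ₗ[k] (Fin (M.d z) → k) :=
  if h : z = x then 0 else (castL k (if_neg h)).toLinearMap

theorem castL_castL {m m' : ℕ} (h : m = m') (h' : m' = m) (v : Fin m → k) :
    castL k h' (castL k h v) = v := by
  subst h; rfl

theorem up_eq {x : Fin n} {Λ : Fin n → Fin n → ℕ} (M : Rep k n Λ) {z : Fin n} (h : z ≠ x) :
    up x M z = (castL k (if_neg h).symm).toLinearMap := dif_neg h

theorem dn_eq {x : Fin n} {Λ : Fin n → Fin n → ℕ} (M : Rep k n Λ) {z : Fin n} (h : z ≠ x) :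
    dn x M z = (castL k (if_neg h)).toLinearMap := dif_neg h

theorem dn_up {x : Fin n} {Λ : Fin n → Fin n → ℕ} (M : Rep k n Λ) {z : Fin n} (h : z ≠ x)
    (v : Fin (M.d z) → k) : dn x M z (up x M z v) = v := by
  rw [up_eq M h, dn_eq M h]
  exact castL_castL _ _ v

theorem up_dn {x : Fin n} {Λ : Fin n → Fin n → ℕ} (M : Rep k n Λ) {z : Fin n} (h : z ≠ x)
    (v : Fin ((reflPlus x Λ M).d z) → k) : up x M z (dn x M z v) = v := by
  rw [up_eq M h, dn_eq M h]
  exact castL_castL _ _ v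

/-- The space at `x` after reflection, embedded in the product. -/
noncomputable def kap (x : Fin n) {Λ : Fin n → Fin n → ℕ} (M : Rep k n Λ) :
    (Fin ((reflPlus x Λ M).d x) → k) →ₗ[k] ((p : Arin Λ x) → (Fin (M.d p.1) → k)) :=
  (LinearMap.ker (inMap Λ M x)).subtype ∘ₗ
          (kerEquiv Λ M x).symm.toLinearMap ∘ₗ (castL k (if_pos rfl)).toLinearMap

/-- Lifting to the kernel. -/
noncomputable def lft (x : Fin n) {Λ : Fin n → Fin n → ℕ} (M : Rep k n Λ) {W : Type}
    [AddCommGroup W] [Module k W] (ψ : W →ₗ[k] ((p : Arin Λ x) → (Fin (M.d p.1) → k)))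
    (h : ∀ w, inMap Λ M x (ψ w) = 0) : W →ₗ[k] (Fin ((reflPlus x Λ M).d x) → k) :=
  (castL k (if_pos rfl).symm).toLinearMap ∘ₗ (kerEquiv Λ M x).toLinearMap ∘ₗ
    ψ.codRestrict (LinearMap.ker (inMap Λ M x)) (fun w => LinearMap.mem_ker.2 (h w))

theorem kap_lft {x : Fin n} {Λ : Fin n → Fin n → ℕ} (M : Rep k n Λ) {W : Type}
    [AddCommGroup W] [Module k W] (ψ : W →ₗ[k] ((p : Arin Λ x) → (Fin (M.d p.1) → k)))
    (h : ∀ w, inMap Λ M x (ψ w) = 0) (w : W) : kap x M (lft x M ψ h w) = ψ w := by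
  change (((kerEquiv Λ M x).symm (castL k (if_pos rfl) (castL k (if_pos rfl).symm (kerEquiv Λ M x
    (ψ.codRestrict (LinearMap.ker (inMap Λ M x)) (fun w => LinearMap.mem_ker.2 (h w)) w))))
      : LinearMap.ker (inMap Λ M x)) : (p : Arin Λ x) → (Fin (M.d p.1) → k)) = ψ w
  rw [castL_castL, LinearEquiv.symm_apply_apply]
  rfl

theorem kap_inj {x : Fin n} {Λ : Fin n → Fin n → ℕ} (M : Rep k n Λ) :
    Function.Injective (kap x M) := by
  refine (Subtype.val_injective).comp
    ((kerEquiv Λ M x).symm.injective.comp (castL k (if_pos rfl)).injective)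

theorem inMap_kap {x : Fin n} {Λ : Fin n → Fin n → ℕ} (M : Rep k n Λ)
    (w : Fin ((reflPlus x Λ M).d x) → k) : inMap Λ M x (kap x M w) = 0 :=
  ((kerEquiv Λ M x).symm (castL k (if_pos rfl) w)).2

theorem exists_kap {x : Fin n} {Λ : Fin n → Fin n → ℕ} (M : Rep k n Λ)
    (v : (p : Arin Λ x) → (Fin (M.d p.1) → k)) (h : inMap Λ M x v = 0) :
    ∃ w, kap x M w = v :=
  ⟨_, kap_lft M (LinearMap.toSpanSingleton k _ v)
    (fun w => by simp [LinearMap.toSpanSingleton_apply, h]) 1 |>.trans (by simp)⟩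

theorem refl_f_ne {x : Fin n} {Λ : Fin n → Fin n → ℕ} (M : Rep k n Λ) {a b : Fin n}
    (ha : a ≠ x) (hb : b ≠ x) (i : Fin (flipO x Λ a b)) (v : Fin ((reflPlus x Λ M).d a) → k) :
    (reflPlus x Λ M).f a b i v =
      up x M b (M.f a b (Fin.cast (by simp [flipO, ha, hb]) i) (dn x M a v)) := by
  rw [up_eq M hb, dn_eq M ha]
  simp only [reflPlus, dif_neg ha, dif_neg hb]
  rfl

theorem refl_f_src {x : Fin n} {Λ : Fin n → Fin n → ℕ} (M : Rep k n Λ) {b : Fin n}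
    (hb : b ≠ x) (i : Fin (flipO x Λ x b)) (v : Fin ((reflPlus x Λ M).d x) → k) :
    (reflPlus x Λ M).f x b i v =
      up x M b (kap x M v ⟨b, Fin.cast (by simp [flipO]) i⟩) := by
  rw [up_eq M hb]
  simp only [reflPlus, dif_neg hb, dite_true]
  rfl

/-- A family of maps is a morphism, between representations of (propositionally) equal quivers. -/
def HomC {Λ Λ' : Fin n → Fin n → ℕ} (h : Λ = Λ') (A : Rep k n Λ) (B : Rep k n Λ')
    (g : ∀ z, (Fin (A.d z) → k) →ₗ[k] (Fin (B.d z) → k)) : Prop :=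
  ∀ a b (i : Fin (Λ a b)) v,
    g b (A.f a b i v) = B.f a b (Fin.cast (by rw [h]) i) (g a v)

/-- Embedding of representations. -/
def Emb {Λ Λ' : Fin n → Fin n → ℕ} (A : Rep k n Λ) (B : Rep k n Λ') : Prop :=
  ∃ (h : Λ = Λ') (g : ∀ z, (Fin (A.d z) → k) →ₗ[k] (Fin (B.d z) → k)),
    HomC h A B g ∧ ∀ z, Function.Injective (g z)

/-- Left exact sequence. -/
def LEx {Λ : Fin n → Fin n → ℕ} (A B C : Rep k n Λ) : Prop :=
  ∃ (g : ∀ z, (Fin (A.d z) → k) →ₗ[k] (Fin (B.d z) → k))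
    (h : ∀ z, (Fin (B.d z) → k) →ₗ[k] (Fin (C.d z) → k)),
    HomC rfl A B g ∧ HomC rfl B C h ∧ (∀ z, Function.Injective (g z)) ∧
      ∀ z v, h z v = 0 → ∃ u, g z u = v

theorem refl_map {x : Fin n} {Λ : Fin n → Fin n → ℕ} (hx : IsSink Λ x) {A B : Rep k n Λ}
    (g : ∀ z, (Fin (A.d z) → k) →ₗ[k] (Fin (B.d z) → k)) (hg : HomC rfl A B g) :
    ∃ g' : ∀ z, (Fin ((reflPlus x Λ A).d z) → k) →ₗ[k] (Fin ((reflPlus x Λ B).d z) → k),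
      HomC rfl (reflPlus x Λ A) (reflPlus x Λ B) g' ∧
      (∀ z, z ≠ x → ∀ v, g' z v = up x B z (g z (dn x A z v))) ∧
      (∀ w p, kap x B (g' x w) p = g p.1 (kap x A w p)) := by
  let ψ : (Fin ((reflPlus x Λ A).d x) → k) →ₗ[k] ((p : Arin Λ x) → (Fin (B.d p.1) → k)) :=
    LinearMap.pi fun p => g p.1 ∘ₗ LinearMap.proj p ∘ₗ kap x A
  have hψ : ∀ w, inMap Λ B x (ψ w) = 0 := by
    intro w
    have h1 : inMap Λ B x (ψ w) = g x (inMap Λ A x (kap x A w)) := by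
      simp only [inMap, LinearMap.sum_apply, map_sum, LinearMap.comp_apply, LinearMap.proj_apply]
      refine Finset.sum_congr rfl fun p _ => ?_
      exact (hg p.1 x p.2 _).symm
    rw [h1, inMap_kap, map_zero]
  let H : ∀ z, (Fin ((reflPlus x Λ A).d z) → k) →ₗ[k] (Fin ((reflPlus x Λ B).d z) → k) :=
    fun z => up x B z ∘ₗ g z ∘ₗ dn x A z
  let G := Function.update H x (lft x B ψ hψ)
  have hGx : G x = lft x B ψ hψ := Function.update_self _ _ _
  have hGne : ∀ z, z ≠ x → ∀ v, G z v = up x B z (g z (dn x A z v)) := by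
    intro z hz v
    have : G z = H z := Function.update_of_ne hz _ _
    rw [this]; rfl
  have hk : ∀ w p, kap x B (G x w) p = g p.1 (kap x A w p) := by
    intro w p
    rw [hGx, kap_lft]; rfl
  refine ⟨G, ?_, hGne, hk⟩
  intro a b i v
  by_cases hb : b = x
  · subst hb
    have h0 : flipO b Λ a b = 0 := by simp [flipO, hx a]
    exact (Fin.cast h0 i).elim0
  · rw [hGne b hb]
    by_cases ha : a = x
    · subst ha
      rw [refl_f_src A hb, refl_f_src B hb, dn_up A hb, hk]
      rfl
    · rw [hGne a ha, refl_f_ne A ha hb, refl_f_ne B ha hb, dn_up A hb, dn_up B ha, hg]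
      rfl

theorem up_inj {x : Fin n} {Λ : Fin n → Fin n → ℕ} (M : Rep k n Λ) {z : Fin n} (h : z ≠ x) :
    Function.Injective (up x M z) := Function.LeftInverse.injective (dn_up M h)

theorem dn_inj {x : Fin n} {Λ : Fin n → Fin n → ℕ} (M : Rep k n Λ) {z : Fin n} (h : z ≠ x) :
    Function.Injective (dn x M z) := Function.LeftInverse.injective (up_dn M h)

theorem refl_map_inj {x : Fin n} {Λ : Fin n → Fin n → ℕ} {A B : Rep k n Λ}
    {g : ∀ z, (Fin (A.d z) → k) →ₗ[k] (Fin (B.d z) → k)}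
    (hi : ∀ z, Function.Injective (g z))
    {g' : ∀ z, (Fin ((reflPlus x Λ A).d z) → k) →ₗ[k] (Fin ((reflPlus x Λ B).d z) → k)}
    (h1 : ∀ z, z ≠ x → ∀ v, g' z v = up x B z (g z (dn x A z v)))
    (h2 : ∀ w p, kap x B (g' x w) p = g p.1 (kap x A w p)) :
    ∀ z, Function.Injective (g' z) := by
  intro z v w hvw
  by_cases hz : z = x
  · subst hz
    apply kap_inj A
    funext p
    apply hi p.1
    rw [← h2, ← h2, hvw]
  · rw [h1 z hz, h1 z hz] at hvw
    exact dn_inj A hz (hi z (up_inj B hz hvw))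

theorem Emb.refl {x : Fin n} {Λ Λ' : Fin n → Fin n → ℕ} (hx : IsSink Λ x) {A : Rep k n Λ}
    {B : Rep k n Λ'} (h : Emb A B) : Emb (reflPlus x Λ A) (reflPlus x Λ' B) := by
  obtain ⟨rfl, g, hg, hi⟩ := h
  obtain ⟨g', h0, h1, h2⟩ := refl_map hx g hg
  exact ⟨rfl, g', h0, refl_map_inj hi h1 h2⟩

theorem LEx.refl {x : Fin n} {Λ : Fin n → Fin n → ℕ} (hx : IsSink Λ x) {A B C : Rep k n Λ}
    (h : LEx A B C) : LEx (reflPlus x Λ A) (reflPlus x Λ B) (reflPlus x Λ C) := by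
  obtain ⟨g, h, hg, hh, hi, hex⟩ := h
  obtain ⟨g', g0, g1, g2⟩ := refl_map hx g hg
  obtain ⟨h', h0, h1, h2⟩ := refl_map hx h hh
  refine ⟨g', h', g0, h0, refl_map_inj hi g1 g2, ?_⟩
  intro z v hv
  by_cases hz : z = x
  · subst hz
    have : ∀ p, ∃ u, g p.1 u = kap z B v p := by
      intro p
      apply hex
      rw [← h2, hv, map_zero]; rfl
    choose u hu using this
    obtain ⟨w, hw⟩ := exists_kap A u (by
      apply hi z
      rw [map_zero, ← inMap_kap B v]
      simp only [inMap, LinearMap.sum_apply, map_sum, LinearMap.comp_apply, LinearMap.proj_apply]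
      refine Finset.sum_congr rfl fun p _ => ?_
      rw [← hu p]
      exact hg p.1 z p.2 _)
    refine ⟨w, kap_inj B ?_⟩
    funext p
    rw [g2, hw, hu]
  · rw [h1 z hz] at hv
    have hv' : h z (dn x B z v) = 0 := up_inj C hz (by rw [hv, map_zero])
    obtain ⟨u, hu⟩ := hex z _ hv'
    refine ⟨up x A z u, ?_⟩
    rw [g1 z hz, dn_up A hz, hu, up_dn B hz]

theorem zero_of_inj {a b : ℕ} (g : (Fin a → k) →ₗ[k] (Fin b → k)) (hg : Function.Injective g)
    (hb : b = 0) : a = 0 := by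
  have := LinearMap.finrank_le_finrank_of_injective hg
  simp at this
  omega

theorem Emb.zero {Λ Λ' : Fin n → Fin n → ℕ} {A : Rep k n Λ}
    {B : Rep k n Λ'} (h : Emb A B) (hB : IsZeroRep B) : IsZeroRep A := by
  obtain ⟨rfl, g, hg, hi⟩ := h
  exact fun z => zero_of_inj (g z) (hi z) (hB z)

theorem LEx.zero {Λ : Fin n → Fin n → ℕ} {A B C : Rep k n Λ}
    (h : LEx A B C) (hA : IsZeroRep A) (hC : IsZeroRep C) : IsZeroRep B := by
  obtain ⟨g, h, hg, hh, hi, hex⟩ := h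
  intro z
  have hsub : Subsingleton (Fin (C.d z) → k) := by rw [hC z]; infer_instance
  have hs : Function.Surjective (g z) := fun v => hex z v (Subsingleton.elim _ _)
  have := LinearMap.finrank_le_finrank_of_surjective hs
  simp [hA z] at this
  exact this

theorem LEx.emb {Λ : Fin n → Fin n → ℕ} {A B C : Rep k n Λ} (h : LEx A B C) : Emb A B := by
  obtain ⟨g, h, hg, hh, hi, hex⟩ := h
  exact ⟨rfl, g, hg, hi⟩

theorem Emb.ann {Λ Λ' : Fin n → Fin n → ℕ} {S : List (Fin n)} (hS : Admissible Λ S)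
    {A : Rep k n Λ} {B : Rep k n Λ'}
    (h : Emb A B) (hB : Annihilates Λ' S B) : Annihilates Λ S A := by
  induction S generalizing Λ Λ' with
  | nil => exact h.zero hB
  | cons x S ih => exact ih hS.2 (h.refl hS.1) hB

theorem LEx.ann {Λ : Fin n → Fin n → ℕ} {S : List (Fin n)} (hS : Admissible Λ S)
    {A B C : Rep k n Λ}
    (h : LEx A B C) (hA : Annihilates Λ S A) (hC : Annihilates Λ S C) : Annihilates Λ S B := by
  induction S generalizing Λ with
  | nil => exact h.zero hA hC
  | cons x S ih => exact ih hS.2 (h.refl hS.1) hA hC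

theorem isZero_refl {x : Fin n} {Λ : Fin n → Fin n → ℕ} {M : Rep k n Λ} (h : IsZeroRep M) :
    IsZeroRep (reflPlus x Λ M) := by
  intro z
  by_cases hz : z = x
  · subst hz
    have : ∀ p : Arin Λ z, Subsingleton (Fin (M.d p.1) → k) := by
      intro p; rw [h p.1]; infer_instance
    have := LinearMap.finrank_le_finrank_of_injective (kap_inj (x := z) M)
    rw [Module.finrank_zero_of_subsingleton (M := ((p : Arin Λ z) → (Fin (M.d p.1) → k)))] at this
    simpa using this
  · exact zero_of_inj _ (dn_inj M hz) (h z)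

theorem ann_of_zero {Λ : Fin n → Fin n → ℕ} (S : List (Fin n)) {M : Rep k n Λ}
    (h : IsZeroRep M) : Annihilates Λ S M := by
  induction S generalizing Λ with
  | nil => exact h
  | cons x S ih => exact ih (isZero_refl h)

theorem d_of_ann {Λ : Fin n → Fin n → ℕ} {S : List (Fin n)} {M : Rep k n Λ}
    (h : Annihilates Λ S M) {v : Fin n} (hv : v ∉ S) : M.d v = 0 := by
  induction S generalizing Λ with
  | nil => exact h v
  | cons x S ih =>
    have h1 : v ≠ x := fun e => hv (by simp [e])
    have := ih (M := reflPlus x Λ M) h (fun h => hv (by simp [h]))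
    exact zero_of_inj _ (up_inj M h1) this

theorem emb_swap {x y : Fin n} {Λ : Fin n → Fin n → ℕ} (hx : IsSink Λ x) (hy : IsSink Λ y)
    (hne : x ≠ y) (M : Rep k n Λ) :
    Emb (reflPlus y _ (reflPlus x Λ M)) (reflPlus x _ (reflPlus y Λ M)) := by
  have hΛ : flipO y (flipO x Λ) = flipO x (flipO y Λ) := flip_comm Λ y x (hy x) (hx y)
  have hyx := hne.symm
  -- reindexing of incoming maps
  have hA1 : ∀ {x y : Fin n}, x ≠ y → IsSink Λ y → ∀ b, b ≠ y → flipO y Λ b x = Λ b x := by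
    intro x y hne _ b hb; simp [flipO, hb, hne]
  have hin : ∀ {x y : Fin n} (hne : x ≠ y) (hx : IsSink Λ x) (hy : IsSink Λ y)
      (u : (p : Arin Λ x) → (Fin (M.d p.1) → k))
      (u' : (p : Arin (flipO y Λ) x) → (Fin ((reflPlus y Λ M).d p.1) → k)),
      (∀ b (hb : b ≠ y) (i : Fin (flipO y Λ b x)),
        dn y M b (u' ⟨b, i⟩) = u ⟨b, Fin.cast (hA1 hne hy b hb) i⟩) →
      inMap (flipO y Λ) (reflPlus y Λ M) x u' = up y M x (inMap Λ M x u) := by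
    intro x y hne hx hy u u' h
    simp only [inMap, LinearMap.sum_apply, map_sum, LinearMap.comp_apply, LinearMap.proj_apply]
    rw [Fintype.sum_sigma, Fintype.sum_sigma]
    refine Finset.sum_congr rfl fun b _ => ?_
    by_cases hb : b = y
    · subst hb
      have : IsEmpty (Fin (flipO b Λ b x)) := by
        rw [show flipO b Λ b x = 0 by simp [flipO, hx b]]; infer_instance
      have : IsEmpty (Fin (Λ b x)) := by rw [hy x]; infer_instance
      simp
    · refine Fintype.sum_equiv (finCongr (hA1 hne hy b hb)) _ _ fun i => ?_
      dsimp only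
      rw [refl_f_ne M hb hne, h b hb]
      rfl
  -- the component at `x`
  let ψx : (Fin ((reflPlus x Λ M).d x) → k) →ₗ[k]
      ((p : Arin (flipO y Λ) x) → (Fin ((reflPlus y Λ M).d p.1) → k)) :=
    LinearMap.pi fun p => if hp : p.1 = y then 0 else
      up y M p.1 ∘ₗ LinearMap.proj (φ := fun p : Arin Λ x => Fin (M.d p.1) → k)
        ⟨p.1, Fin.cast (hA1 hne hy p.1 hp) p.2⟩ ∘ₗ kap x M
  have ψx_apply : ∀ w b (hb : b ≠ y) i, ψx w ⟨b, i⟩ =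
      up y M b (kap x M w ⟨b, Fin.cast (hA1 hne hy b hb) i⟩) := by
    intro w b hb i
    simp [ψx, hb]
  have hψx : ∀ w, inMap (flipO y Λ) (reflPlus y Λ M) x (ψx w) = 0 := by
    intro w
    rw [hin hne hx hy (kap x M w) (ψx w), inMap_kap, map_zero]
    intro b hb i
    rw [ψx_apply w b hb, dn_up M hb]
  let gx := lft x (reflPlus y Λ M) ψx hψx ∘ₗ dn y (reflPlus x Λ M) x
  -- the component at `y`
  let ψy : (Fin ((reflPlus y _ (reflPlus x Λ M)).d y) → k) →ₗ[k]
      ((p : Arin Λ y) → (Fin (M.d p.1) → k)) :=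
    LinearMap.pi fun p => if hp : p.1 = x then 0 else
      dn x M p.1 ∘ₗ LinearMap.proj
        (φ := fun p : Arin (flipO x Λ) y => Fin ((reflPlus x Λ M).d p.1) → k)
        ⟨p.1, Fin.cast (hA1 hyx hx p.1 hp).symm p.2⟩ ∘ₗ kap y (reflPlus x Λ M)
  have ψy_apply : ∀ w b (hb : b ≠ x) i, ψy w ⟨b, i⟩ =
      dn x M b (kap y (reflPlus x Λ M) w ⟨b, Fin.cast (hA1 hyx hx b hb).symm i⟩) := by
    intro w b hb i
    simp [ψy, hb]
  have hψy : ∀ w, inMap Λ M y (ψy w) = 0 := by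
    intro w
    apply up_inj M hyx
    rw [map_zero, ← hin hyx hy hx (ψy w) (kap y (reflPlus x Λ M) w), inMap_kap]
    intro b hb i
    rw [ψy_apply w b hb]
    rfl
  let gy := up x (reflPlus y Λ M) y ∘ₗ lft y M ψy hψy
  let G0 : ∀ z, (Fin ((reflPlus y _ (reflPlus x Λ M)).d z) → k) →ₗ[k]
      (Fin ((reflPlus x _ (reflPlus y Λ M)).d z) → k) := fun z =>
    up x (reflPlus y Λ M) z ∘ₗ up y M z ∘ₗ dn x M z ∘ₗ dn y (reflPlus x Λ M) z
  let G := Function.update (Function.update G0 x gx) y gy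
  have hGy : G y = gy := Function.update_self _ _ _
  have hGx : G x = gx := (Function.update_of_ne hne _ _).trans (Function.update_self _ _ _)
  have hG : ∀ z, z ≠ x → z ≠ y → ∀ v, G z v =
      up x (reflPlus y Λ M) z (up y M z (dn x M z (dn y (reflPlus x Λ M) z v))) := by
    intro z h1 h2 v
    have : G z = G0 z := (Function.update_of_ne h2 _ _).trans (Function.update_of_ne h1 _ _)
    rw [this]; rfl
  refine ⟨hΛ, G, ?_, ?_⟩
  · intro a b i v
    by_cases hbx : b = x
    · subst hbx
      have h0 : flipO y (flipO b Λ) a b = 0 := by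
        rw [hΛ]; simp [flipO, hne, hx a]; rintro rfl; exact hy b
      exact (Fin.cast h0 i).elim0
    by_cases hby : b = y
    · subst hby
      have h0 : flipO b (flipO x Λ) a b = 0 := by
        simp [flipO, hyx, hy a]; rintro rfl; exact hx b
      exact (Fin.cast h0 i).elim0
    rw [hG b hbx hby]
    by_cases hax : a = x
    · subst hax
      rw [refl_f_ne _ hne hby, refl_f_src _ hbx, refl_f_src _ hbx, dn_up _ hby, dn_up _ hbx,
        hGx]
      simp only [gx, LinearMap.comp_apply, kap_lft]
      rw [ψx_apply _ b hby]
      rfl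
    by_cases hay : a = y
    · subst hay
      rw [refl_f_src _ hby, refl_f_ne _ hax hbx, refl_f_src _ hby, dn_up _ hby, hGy]
      simp only [gy, LinearMap.comp_apply]
      rw [dn_up _ hax, kap_lft, ψy_apply _ b hbx]
      rfl
    · rw [refl_f_ne _ hay hby, refl_f_ne _ hax hbx, dn_up _ hby, dn_up _ hbx,
        refl_f_ne _ hax hbx, refl_f_ne _ hay hby, hG a hax hay, dn_up _ hax, dn_up _ hay]
      rfl
  · intro z v w hvw
    by_cases hzx : z = x
    · subst hzx
      rw [hGx] at hvw
      apply dn_inj _ hne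
      apply kap_inj
      have h1 := congrArg (kap z (reflPlus y Λ M)) hvw
      simp only [gx, LinearMap.comp_apply, kap_lft] at h1
      funext ⟨b, i⟩
      by_cases hb : b = y
      · subst hb; exact (Fin.cast (hy z) i).elim0
      · have h2 := congrFun h1 ⟨b, Fin.cast (hA1 hne hy b hb).symm i⟩
        rw [ψx_apply _ b hb, ψx_apply _ b hb] at h2
        exact up_inj _ hb h2
    by_cases hzy : z = y
    · subst hzy
      rw [hGy] at hvw
      apply kap_inj
      have h1 := congrArg (kap z M) (up_inj _ hyx hvw)
      simp only [kap_lft] at h1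
      funext ⟨b, i⟩
      by_cases hb : b = x
      · subst hb
        exact (Fin.cast (show flipO b Λ b z = 0 by simp [flipO, hy b]) i).elim0
      · have h2 := congrFun h1 ⟨b, Fin.cast (hA1 hyx hx b hb) i⟩
        rw [ψy_apply _ b hb, ψy_apply _ b hb] at h2
        exact dn_inj _ hb h2
    · rw [hG z hzx hzy, hG z hzx hzy] at hvw
      exact dn_inj _ hzy (dn_inj _ hzx (up_inj _ hzy (up_inj _ hzx hvw)))

theorem ann_front {Λ : Fin n → Fin n → ℕ} {T : List (Fin n)} {x : Fin n} {M : Rep k n Λ}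
    (hT : Admissible Λ T) (hx : IsSink Λ x) (hm : x ∈ T) :
    Annihilates Λ T M ↔ Annihilates (flipO x Λ) (T.erase x) (reflPlus x Λ M) := by
  induction T generalizing Λ with
  | nil => simp at hm
  | cons z T ih =>
    by_cases hzx : z = x
    · subst hzx
      simp only [List.erase_cons_head]
      rfl
    · have hm' : x ∈ T := by simpa [Ne.symm hzx] using hm
      have h1 := front hT.2 (sink_flip hx hT.1 (Ne.symm hzx)) hm'
      have h2 := front hT hx hm
      rw [List.erase_cons_tail (by simpa using hzx)] at h2 ⊢
      refine (ih (M := reflPlus z Λ M) hT.2 (sink_flip hx hT.1 (Ne.symm hzx)) hm').trans ?_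
      constructor
      · intro h
        exact (emb_swap hx hT.1 (Ne.symm hzx) M).ann h2.1.2 h
      · intro h
        exact (emb_swap hT.1 hx hzx M).ann h1.1 h

theorem ann_mono {Λ : Fin n → Fin n → ℕ} {S T : List (Fin n)} {M : Rep k n Λ}
    (hS : Admissible Λ S) (hT : Admissible Λ T) (h : ∀ v, S.count v ≤ T.count v)
    (hA : Annihilates Λ S M) : Annihilates Λ T M := by
  induction S generalizing Λ T with
  | nil => exact ann_of_zero T hA
  | cons x S ih =>
    have hm : x ∈ T := by
      have := h x
      rw [List.count_cons_self] at this
      exact List.count_pos_iff.1 (by omega)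
    have h1 := front hT hS.1 hm
    rw [ann_front hT hS.1 hm]
    refine ih hS.2 h1.1 ?_ hA
    intro v
    have := h v
    rw [h1.2.perm.count_eq v] at this
    simp only [List.count_cons] at this
    omega

theorem common_sink {Λ : Fin n → Fin n → ℕ} (hs : Simp Λ) {S T : List (Fin n)}
    (hS : Admissible Λ S) (hT : Admissible Λ T) (h : ∃ v ∈ S, v ∈ T) :
    ∃ v, IsSink Λ v ∧ v ∈ S ∧ v ∈ T := by
  obtain ⟨v0, hv0, hv0'⟩ := h
  have hsome : (S.find? (fun v => decide (v ∈ T))).isSome := by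
    rw [List.find?_isSome]; exact ⟨v0, hv0, by simpa using hv0'⟩
  obtain ⟨v, hv⟩ := Option.isSome_iff_exists.1 hsome
  obtain ⟨hvT, S1, S2, rfl, hS1⟩ := List.find?_eq_some_iff_append.1 hv
  have hvT : v ∈ T := by simpa using hvT
  refine ⟨v, ?_, by simp, hvT⟩
  intro w
  by_contra hw
  have hvw : v ≠ w := by rintro rfl; have := hs v v; tauto
  have hpre : Admissible Λ (S1 ++ [v]) := by
    clear hv hsome hv0 hv0' hS1 hw hvT hT hs
    induction S1 generalizing Λ with
    | nil => exact ⟨hS.1, trivial⟩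
    | cons z S1 ih => exact ⟨hS.1, ih hS.2⟩
  have h1 := (hpre.compat hs v w hw).1
  have h2 := (hT.compat hs v w hw).1
  have hwT : w ∈ T := List.count_pos_iff.1 (lt_of_lt_of_le (List.count_pos_iff.2 hvT) h2)
  have hwS : w ∈ S1 ++ [v] :=
    List.count_pos_iff.1 (lt_of_lt_of_le (List.count_pos_iff.2 (by simp)) h1)
  have hwS : w ∈ S1 := by simpa [hvw.symm] using hwS
  have := hS1 w hwS
  simp [hwT] at this

theorem ann_meet {Λ : Fin n → Fin n → ℕ} (hs : Simp Λ) {S T : List (Fin n)} {M : Rep k n Λ}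
    (hS : Admissible Λ S) (hT : Admissible Λ T)
    (hSA : Annihilates Λ S M) (hTA : Annihilates Λ T M) :
    ∃ R, Admissible Λ R ∧ Annihilates Λ R M ∧ ∀ v, R.count v ≤ S.count v ∧ R.count v ≤ T.count v := by
  induction hN : S.length generalizing Λ S T with
  | zero =>
    have := List.length_eq_zero_iff.1 hN
    subst this
    exact ⟨[], trivial, hSA, by simp⟩
  | succ N ih =>
    by_cases h : ∃ v ∈ S, v ∈ T
    · obtain ⟨v, hv, hvS, hvT⟩ := common_sink hs hS hT h
      have h1 := front hS hv hvS
      have h2 := front hT hv hvT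
      obtain ⟨R, hR, hRA, hc⟩ := ih (hs.flip v) h1.1 h2.1 ((ann_front hS hv hvS).1 hSA)
        ((ann_front hT hv hvT).1 hTA) (by rw [List.length_erase_of_mem hvS]; omega)
      refine ⟨v :: R, ⟨hv, hR⟩, hRA, fun u => ?_⟩
      have := hc u
      rw [h1.2.perm.count_eq u, h2.2.perm.count_eq u]
      simp only [List.count_cons]
      omega
    · push Not at h
      refine ⟨[], trivial, fun v => ?_, by simp⟩
      by_cases hv : v ∈ S
      · exact d_of_ann hTA (h v hv)
      · exact d_of_ann hSA hv

/-- `S` is least among annihilating sequences. -/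
def IsLeastAnn (Λ : Fin n → Fin n → ℕ) (M : Rep k n Λ) (S : List (Fin n)) : Prop :=
  Admissible Λ S ∧ Annihilates Λ S M ∧
    ∀ T, Admissible Λ T → Annihilates Λ T M → ∀ v, S.count v ≤ T.count v

theorem exists_least {Λ : Fin n → Fin n → ℕ} (hs : Simp Λ) {M : Rep k n Λ}
    (hM : Preprojective Λ M) : ∃ S, IsLeastAnn Λ M S := by
  classical
  have hex : ∃ l, ∃ S, Admissible Λ S ∧ Annihilates Λ S M ∧ S.length = l := by
    obtain ⟨S, h1, h2⟩ := hM
    exact ⟨_, S, h1, h2, rfl⟩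
  obtain ⟨S, h1, h2, h3⟩ := Nat.find_spec hex
  refine ⟨S, h1, h2, fun T hT hTA v => ?_⟩
  obtain ⟨R, hR, hRA, hc⟩ := ann_meet hs h1 hT h2 hTA
  have hlen : S.length ≤ R.length := by
    rw [h3]; exact Nat.find_min' hex ⟨R, hR, hRA, rfl⟩
  have hsub : R.Subperm S := List.subperm_iff_count.2 fun v => (hc v).1
  have hperm := hsub.perm_of_length_le hlen
  rw [← hperm.count_eq v]
  exact (hc v).2

theorem IsLeastAnn.shortest {Λ : Fin n → Fin n → ℕ} {M : Rep k n Λ} {S : List (Fin n)}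
    (h : IsLeastAnn Λ M S) : IsShortestAnn Λ M S := by
  refine ⟨h.1, h.2.1, fun S' h1 h2 h3 => sim_of_count h.1 h1 fun v => ?_⟩
  exact le_antisymm (h.2.2 S' h1 h2 v) (h3.count v)

theorem IsShortestAnn.least {Λ : Fin n → Fin n → ℕ} (hs : Simp Λ) {M : Rep k n Λ}
    {S : List (Fin n)} (h : IsShortestAnn Λ M S) : IsLeastAnn Λ M S := by
  obtain ⟨S0, h0⟩ := exists_least hs ⟨S, h.1, h.2.1⟩
  have hsim := h.2.2 S0 h0.1 h0.2.1 (preceq_of_count h0.1 h.1 (h0.2.2 S h.1 h.2.1))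
  refine ⟨h.1, h.2.1, fun T hT hTA v => ?_⟩
  rw [← hsim.perm.count_eq v]
  exact h0.2.2 T hT hTA v

theorem lex_dSum {Λ : Fin n → Fin n → ℕ} (M N : Rep k n Λ) : LEx M (dSum M N) N := by
  refine ⟨fun z => (splitL k (M.d z) (N.d z)).symm.toLinearMap ∘ₗ LinearMap.inl k _ _,
    fun z => LinearMap.snd k _ _ ∘ₗ (splitL k (M.d z) (N.d z)).toLinearMap, ?_, ?_, ?_, ?_⟩
  · intro a b i v
    change (splitL k (M.d b) (N.d b)).symm ((M.f a b i v), 0) =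
      (splitL k (M.d b) (N.d b)).symm (LinearMap.prodMap (M.f a b i) (N.f a b i)
        (splitL k (M.d a) (N.d a) ((splitL k (M.d a) (N.d a)).symm (v, 0))))
    rw [LinearEquiv.apply_symm_apply]
    simp
  · intro a b i v
    change ((splitL k (M.d b) (N.d b)) ((splitL k (M.d b) (N.d b)).symm
      (LinearMap.prodMap (M.f a b i) (N.f a b i) (splitL k (M.d a) (N.d a) v)))).2 =
        N.f a b i (splitL k (M.d a) (N.d a) v).2
    rw [LinearEquiv.apply_symm_apply]
    simp
  · intro z
    exact (splitL k (M.d z) (N.d z)).symm.injective.comp LinearMap.inl_injective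
  · intro z v hv
    refine ⟨(splitL k (M.d z) (N.d z) v).1, (splitL k (M.d z) (N.d z)).injective ?_⟩
    have hv' : (splitL k (M.d z) (N.d z) v).2 = 0 := hv
    change splitL k (M.d z) (N.d z) ((splitL k (M.d z) (N.d z)).symm
      ((splitL k (M.d z) (N.d z) v).1, 0)) = _
    rw [LinearEquiv.apply_symm_apply, ← hv']

theorem lex_dSum' {Λ : Fin n → Fin n → ℕ} (M N : Rep k n Λ) : LEx N (dSum M N) M := by
  refine ⟨fun z => (splitL k (M.d z) (N.d z)).symm.toLinearMap ∘ₗ LinearMap.inr k _ _,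
    fun z => LinearMap.fst k _ _ ∘ₗ (splitL k (M.d z) (N.d z)).toLinearMap, ?_, ?_, ?_, ?_⟩
  · intro a b i v
    change (splitL k (M.d b) (N.d b)).symm (0, (N.f a b i v)) =
      (splitL k (M.d b) (N.d b)).symm (LinearMap.prodMap (M.f a b i) (N.f a b i)
        (splitL k (M.d a) (N.d a) ((splitL k (M.d a) (N.d a)).symm (0, v))))
    rw [LinearEquiv.apply_symm_apply]
    simp
  · intro a b i v
    change ((splitL k (M.d b) (N.d b)) ((splitL k (M.d b) (N.d b)).symm
      (LinearMap.prodMap (M.f a b i) (N.f a b i) (splitL k (M.d a) (N.d a) v)))).1 =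
        M.f a b i (splitL k (M.d a) (N.d a) v).1
    rw [LinearEquiv.apply_symm_apply]
    simp
  · intro z
    exact (splitL k (M.d z) (N.d z)).symm.injective.comp LinearMap.inr_injective
  · intro z v hv
    refine ⟨(splitL k (M.d z) (N.d z) v).2, (splitL k (M.d z) (N.d z)).injective ?_⟩
    have hv' : (splitL k (M.d z) (N.d z) v).1 = 0 := hv
    change splitL k (M.d z) (N.d z) ((splitL k (M.d z) (N.d z)).symm
      (0, (splitL k (M.d z) (N.d z) v).2)) = _
    rw [LinearEquiv.apply_symm_apply, ← hv']

theorem ann_dSumList {Λ : Fin n → Fin n → ℕ} {S : List (Fin n)} (hS : Admissible Λ S)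
    (L : List (Rep k n Λ)) :
    Annihilates Λ S (dSumList L) ↔ ∀ N ∈ L, Annihilates Λ S N := by
  induction L with
  | nil =>
    simp only [List.not_mem_nil, false_imp_iff, implies_true, iff_true]
    exact ann_of_zero S (fun _ => rfl)
  | cons N L ih =>
    rw [List.forall_mem_cons, ← ih]
    constructor
    · intro h
      exact ⟨(lex_dSum N (dSumList L)).emb.ann hS h, (lex_dSum' N (dSumList L)).emb.ann hS h⟩
    · rintro ⟨h1, h2⟩
      exact (lex_dSum N (dSumList L)).ann hS h1 h2

theorem RepIso.ann {Λ : Fin n → Fin n → ℕ} {S : List (Fin n)} (hS : Admissible Λ S)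
    {A B : Rep k n Λ} (h : RepIso A B) : Annihilates Λ S A ↔ Annihilates Λ S B := by
  obtain ⟨g, hg⟩ := h
  constructor
  · have : Emb B A := ⟨rfl, fun z => (g z).symm.toLinearMap, by
      intro a b i v
      apply (g b).injective
      simp [hg], fun z => (g z).symm.injective⟩
    exact this.ann hS
  · have : Emb A B := ⟨rfl, fun z => (g z).toLinearMap, by
      intro a b i v
      simp [hg], fun z => (g z).injective⟩
    exact this.ann hS

theorem maxCount_le {Ts : List (List (Fin n))} {v : Fin n} {m : ℕ} :
    maxCount Ts v ≤ m ↔ ∀ T ∈ Ts, T.count v ≤ m := by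
  induction Ts with
  | nil => simp [maxCount]
  | cons T Ts ih =>
    simp only [maxCount, List.foldr_cons, List.forall_mem_cons, max_le_iff] at ih ⊢
    rw [ih]

theorem shortest_exists_unique_and_is_join
    (n : ℕ) (hn : 2 ≤ n) (Λ : Fin n → Fin n → ℕ)
    (hloop : ∀ a, Λ a a = 0)
    (hconn : ∀ a b : Fin n, Relation.ReflTransGen (fun u v => edges Λ u v ≠ 0) a b)
    (hacyc : ∀ a : Fin n, ¬ Relation.TransGen (fun u v => Λ u v ≠ 0) a a)
    (k : Type) [Field k]
    (M : Rep k n Λ) (hM : Preprojective Λ M) :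
    (∃ S, IsShortestAnn Λ M S) ∧
    (∀ S S', IsShortestAnn Λ M S → IsShortestAnn Λ M S' → Sim (edges Λ) S S') ∧
    (∀ (t : ℕ) (Ms : Fin t → Rep k n Λ) (m : Fin t → ℕ),
      (∀ i, Indecomp (Ms i)) →
      (∀ i j, i ≠ j → ¬ RepIso (Ms i) (Ms j)) →
      (∀ i, 0 < m i) →
      RepIso M (dSumList ((List.ofFn fun i => List.replicate (m i) (Ms i)).flatten)) →
      (∀ i, Preprojective Λ (Ms i)) ∧
      ∀ (SM : List (Fin n)) (SMs : Fin t → List (Fin n)),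
        IsShortestAnn Λ M SM → (∀ i, IsShortestAnn Λ (Ms i) (SMs i)) →
        IsJoinList Λ (List.ofFn SMs) SM) := by
  have hs : Simp Λ := by
    intro a b
    by_contra hcon
    push Not at hcon
    exact hacyc a (Relation.TransGen.head hcon.1 (Relation.TransGen.single hcon.2))
  refine ⟨?_, ?_, ?_⟩
  · obtain ⟨S, hS⟩ := exists_least hs hM
    exact ⟨S, hS.shortest⟩
  · intro S S' h h'
    have h1 := h.least hs
    have h2 := h'.least hs
    exact sim_of_count h2.1 h1.1 fun v =>
      le_antisymm (h2.2.2 S h1.1 h1.2.1 v) (h1.2.2 S' h2.1 h2.2.1 v)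
  · intro t Ms m _ _ hm hiso
    have hmem : ∀ N, N ∈ (List.ofFn fun i => List.replicate (m i) (Ms i)).flatten ↔
        ∃ i, N = Ms i := by
      intro N
      simp only [List.mem_flatten, List.mem_ofFn]
      constructor
      · rintro ⟨l, ⟨i, rfl⟩, hN⟩
        exact ⟨i, List.eq_of_mem_replicate hN⟩
      · rintro ⟨i, rfl⟩
        exact ⟨_, ⟨i, rfl⟩, List.mem_replicate.2 ⟨(hm i).ne', rfl⟩⟩
    have key : ∀ S, Admissible Λ S →
        (Annihilates Λ S M ↔ ∀ i, Annihilates Λ S (Ms i)) := by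
      intro S hS
      rw [RepIso.ann hS hiso, ann_dSumList hS]
      constructor
      · intro h i
        exact h _ ((hmem _).2 ⟨i, rfl⟩)
      · intro h N hN
        obtain ⟨i, rfl⟩ := (hmem N).1 hN
        exact h i
    refine ⟨fun i => ?_, ?_⟩
    · obtain ⟨S, h1, h2⟩ := hM
      exact ⟨S, h1, (key S h1).1 h2 i⟩
    · intro SM SMs hSM hSMs
      have h1 := hSM.least hs
      have h2 : ∀ i, IsLeastAnn Λ (Ms i) (SMs i) := fun i => (hSMs i).least hs
      have hadm : ∀ T ∈ List.ofFn SMs, Admissible Λ T := by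
        intro T hT
        obtain ⟨i, rfl⟩ := List.mem_ofFn.1 hT
        exact (h2 i).1
      refine isJoinList_of_count hs hacyc _ hadm SM h1.1 ?_
      obtain ⟨J, hJ, hJc⟩ := exists_max hs hacyc _ hadm
      intro v
      apply le_antisymm
      · rw [← hJc v]
        refine h1.2.2 J hJ ((key J hJ).2 fun i => ?_) v
        refine ann_mono (h2 i).1 hJ (fun u => ?_) (h2 i).2.1
        rw [hJc u]
        exact maxCount_le.1 le_rfl _ (List.mem_ofFn.2 ⟨i, rfl⟩)
      · refine maxCount_le.2 fun T hT => ?_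
        obtain ⟨i, rfl⟩ := List.mem_ofFn.1 hT
        exact (h2 i).2.2 SM h1.1 ((key SM h1.1).1 h1.2.1 i) v

end KP
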